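/- arXiv:1712.07725 — 7 statements merged into one kernel-verified Lean document; each statement's English description precedes it below -/
import Mathlib

section
/- For every n and every pair of nonzero vectors a, b ∈ ℂ^{n+1}, there exist a matrix U in the special unitary group SU(n+1) and a nonzero scalar c ∈ ℂ such that U·a = c • b. In other words, SU(n+1) acts transitively on the complex projective space ℂP^n. -/
/-- Every nonzero vector is, up to a nonzero scalar, a given column of a unitary matrix. -/
theorem exists_mem_unitaryGroup_mulVec_single {ι : Type*} [Fintype ι] [DecidableEq ι] (i : ι)
    {a : ι → ℂ} (ha : a ≠ 0) :
    ∃ V ∈ Matrix.unitaryGroup ι ℂ, ∃ c : ℂ, c ≠ 0 ∧ V.mulVec (Pi.single i 1) = c • a := by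
  set x : EuclideanSpace ℂ ι := WithLp.toLp 2 a
  have hx : ‖x‖ ≠ 0 := by simpa [x] using ha
  have hunit : Orthonormal ℂ
      (({i} : Set ι).domRestrict fun _ : ι => ((‖x‖⁻¹ : ℝ) : ℂ) • x) := by
    refine ⟨fun _ => ?_, fun j k hjk => (hjk (Subsingleton.elim j k)).elim⟩
    simp [norm_smul, hx]
  obtain ⟨v, hv⟩ := hunit.exists_orthonormalBasis_extension_of_card_eq (by simp)
  refine ⟨_, (EuclideanSpace.basisFun ι ℂ).toMatrix_orthonormalBasis_mem_unitary v,
    ((‖x‖⁻¹ : ℝ) : ℂ), by simpa using hx, ?_⟩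
  ext j
  simp [Module.Basis.toMatrix_apply, hv i rfl, x]

/-- A unitary matrix can be rescaled by a nonzero scalar to a special unitary matrix. -/
theorem exists_smul_mem_specialUnitaryGroup {ι : Type*} [Fintype ι] [DecidableEq ι] [Nonempty ι]
    {V : Matrix ι ι ℂ} (hV : V ∈ Matrix.unitaryGroup ι ℂ) :
    ∃ μ : ℂ, μ ≠ 0 ∧ μ • V ∈ Matrix.specialUnitaryGroup ι ℂ := by
  have hdet : ‖V.det‖ = 1 := CStarRing.norm_of_mem_unitary (Matrix.det_of_mem_unitary hV)
  obtain ⟨μ, hμ⟩ := IsAlgClosed.exists_pow_nat_eq (V.det)⁻¹ (Fintype.card_pos (α := ι))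
  have hnorm : ‖μ‖ = 1 := by
    rw [← pow_eq_one_iff_of_nonneg (norm_nonneg μ) (Fintype.card_ne_zero (α := ι)), ← norm_pow,
      hμ, norm_inv, hdet, inv_one]
  have hdet0 : V.det ≠ 0 := norm_ne_zero_iff.mp (by simp [hdet])
  refine ⟨μ, norm_ne_zero_iff.mp (by simp [hnorm]),
    Matrix.mem_specialUnitaryGroup_iff.mpr ⟨?_, ?_⟩⟩
  · rw [Matrix.mem_unitaryGroup_iff'] at hV ⊢
    rw [star_smul, smul_mul_smul_comm, hV, Complex.star_def, Complex.conj_mul', hnorm]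
    simp
  · rw [Matrix.det_smul, hμ, inv_mul_cancel₀ hdet0]


/-- `SU(n+1)` acts transitively on `ℂPⁿ`: for any two nonzero vectors
`a, b ∈ ℂ^{n+1}` there exist `U ∈ SU(n+1)` and a nonzero scalar `c` with
`U · a = c • b`. -/
theorem SU_transitive_on_CPn (n : ℕ) (a b : Fin (n + 1) → ℂ)
    (ha : a ≠ 0) (hb : b ≠ 0) :
    ∃ (U : Matrix (Fin (n + 1)) (Fin (n + 1)) ℂ) (c : ℂ),
      U.conjTranspose * U = 1 ∧ U.det = 1 ∧ c ≠ 0 ∧ U.mulVec a = c • b := by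
  obtain ⟨V, hV, s, hs, hVa⟩ := exists_mem_unitaryGroup_mulVec_single 0 ha
  obtain ⟨W, hW, t, ht, hWb⟩ := exists_mem_unitaryGroup_mulVec_single 0 hb
  obtain ⟨μ, hμ, hU⟩ := exists_smul_mem_specialUnitaryGroup (mul_mem hW (Unitary.star_mem hV))
  obtain ⟨hunitary, hdet⟩ := Matrix.mem_specialUnitaryGroup_iff.mp hU
  refine ⟨μ • (W * star V), μ * (s⁻¹ * t), Matrix.mem_unitaryGroup_iff'.mp hunitary, hdet,
    by simp [hμ, hs, ht], ?_⟩
  have hVa' : a = s⁻¹ • V.mulVec (Pi.single 0 1) := by rw [hVa, inv_smul_smul₀ hs]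
  rw [hVa', Matrix.mulVec_smul, Matrix.smul_mulVec, Matrix.mulVec_mulVec, mul_assoc,
    Matrix.mem_unitaryGroup_iff'.mp hV, mul_one, hWb]
  simp only [smul_smul]
  ring_nf
end

section
/- Let j₀, j₁ : ℝ × ℝ → M_n(ℝ) be differentiable matrix-valued fields on two-dimensional Minkowski space (coordinates (x⁰, x¹), metric signature (+,−)). Then the following are equivalent: (1) the current conservation equation ∂₀ j₀ = ∂₁ j₁ and the flatness (zero-curvature) equation ∂₀ j₁ − ∂₁ j₀ + j₀ j₁ − j₁ j₀ = 0 both hold everywhere; (2) for every real z with z² ≠ 1, the Lax connection L₀ = (1 − z²)⁻¹ (j₀ − z j₁), L₁ = (1 − z²)⁻¹ (j₁ − z j₀) has zero curvature: ∂₀ L₁ − ∂₁ L₀ + L₀ L₁ − L₁ L₀ = 0 everywhere. (This is the Lax/zero-curvature representation of the principal chiral field equations.) -/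
attribute [local instance] Matrix.normedAddCommGroup Matrix.normedSpace

/-- Partial derivative in the first coordinate direction. -/
noncomputable def pd0 {n : ℕ} (f : ℝ × ℝ → Matrix (Fin n) (Fin n) ℝ)
    (x : ℝ × ℝ) : Matrix (Fin n) (Fin n) ℝ :=
  fderiv ℝ f x (1, 0)

/-- Partial derivative in the second coordinate direction. -/
noncomputable def pd1 {n : ℕ} (f : ℝ × ℝ → Matrix (Fin n) (Fin n) ℝ)
    (x : ℝ × ℝ) : Matrix (Fin n) (Fin n) ℝ :=
  fderiv ℝ f x (0, 1)

theorem fderiv_smul_sub_smul_apply {E F : Type*} [NormedAddCommGroup E] [NormedSpace ℝ E]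
    [NormedAddCommGroup F] [NormedSpace ℝ F] {f g : E → F} {x : E}
    (hf : DifferentiableAt ℝ f x) (hg : DifferentiableAt ℝ g x) (c z : ℝ) (v : E) :
    fderiv ℝ (fun y => c • (f y - z • g y)) x v =
      c • (fderiv ℝ f x v - z • fderiv ℝ g x v) := by
  have h := ((hf.hasFDerivAt.sub (hg.hasFDerivAt.const_smul z)).const_smul c).fderiv
  exact DFunLike.congr_fun h v

/-- The commutator of the two components of the Lax connection. -/
theorem lax_commutator {A : Type*} [Ring A] [Algebra ℝ A] (a b : A) {z : ℝ} (hz : z ^ 2 ≠ 1) :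
    ((1 - z ^ 2)⁻¹ • (a - z • b)) * ((1 - z ^ 2)⁻¹ • (b - z • a))
      - ((1 - z ^ 2)⁻¹ • (b - z • a)) * ((1 - z ^ 2)⁻¹ • (a - z • b))
      = (1 - z ^ 2)⁻¹ • (a * b - b * a) := by
  have hz' : 1 - z ^ 2 ≠ 0 := sub_ne_zero.mpr hz.symm
  have key : (a - z • b) * (b - z • a) - (b - z • a) * (a - z • b)
      = (1 - z ^ 2) • (a * b - b * a) := by
    simp only [sub_mul, mul_sub, smul_mul_assoc, mul_smul_comm, smul_sub]
    module
  rw [smul_mul_smul_comm, smul_mul_smul_comm, ← smul_sub, key, smul_smul,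
    mul_assoc, inv_mul_cancel₀ hz', mul_one]

/-- The curvature of the Lax connection is a combination of the curvature of the current and
the failure of its conservation. -/
theorem lax_curvature {n : ℕ} {j₀ j₁ : ℝ × ℝ → Matrix (Fin n) (Fin n) ℝ}
    (hj₀ : Differentiable ℝ j₀) (hj₁ : Differentiable ℝ j₁) {z : ℝ} (hz : z ^ 2 ≠ 1) (x : ℝ × ℝ) :
    pd0 (fun y => (1 - z ^ 2)⁻¹ • (j₁ y - z • j₀ y)) x
          - pd1 (fun y => (1 - z ^ 2)⁻¹ • (j₀ y - z • j₁ y)) x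
          + (((1 - z ^ 2)⁻¹ • (j₀ x - z • j₁ x)) * ((1 - z ^ 2)⁻¹ • (j₁ x - z • j₀ x))
            - ((1 - z ^ 2)⁻¹ • (j₁ x - z • j₀ x)) * ((1 - z ^ 2)⁻¹ • (j₀ x - z • j₁ x)))
      = (1 - z ^ 2)⁻¹ • ((pd0 j₁ x - pd1 j₀ x + (j₀ x * j₁ x - j₁ x * j₀ x))
          - z • (pd0 j₀ x - pd1 j₁ x)) := by
  rw [lax_commutator _ _ hz]
  have h0 : pd0 (fun y => (1 - z ^ 2)⁻¹ • (j₁ y - z • j₀ y)) x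
      = (1 - z ^ 2)⁻¹ • (pd0 j₁ x - z • pd0 j₀ x) :=
    fderiv_smul_sub_smul_apply (hj₁ x) (hj₀ x) _ z (1, 0)
  have h1 : pd1 (fun y => (1 - z ^ 2)⁻¹ • (j₀ y - z • j₁ y)) x
      = (1 - z ^ 2)⁻¹ • (pd1 j₀ x - z • pd1 j₁ x) :=
    fderiv_smul_sub_smul_apply (hj₀ x) (hj₁ x) _ z (0, 1)
  rw [h0, h1]
  module

/-- The principal chiral field equations (current conservation + flatness) hold
iff the Lax connection `L = (j + z * j)/(1 - z²)` is flat for every `z` with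
`z² ≠ 1`. -/
theorem lax_representation_principal_chiral_field {n : ℕ}
    (j₀ j₁ : ℝ × ℝ → Matrix (Fin n) (Fin n) ℝ)
    (hj₀ : Differentiable ℝ j₀) (hj₁ : Differentiable ℝ j₁) :
    ((∀ x, pd0 j₀ x = pd1 j₁ x) ∧
      (∀ x, pd0 j₁ x - pd1 j₀ x + (j₀ x * j₁ x - j₁ x * j₀ x) = 0)) ↔
    (∀ z : ℝ, z ^ 2 ≠ 1 →
      ∀ x, pd0 (fun y => (1 - z ^ 2)⁻¹ • (j₁ y - z • j₀ y)) x
          - pd1 (fun y => (1 - z ^ 2)⁻¹ • (j₀ y - z • j₁ y)) x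
          + (((1 - z ^ 2)⁻¹ • (j₀ x - z • j₁ x)) * ((1 - z ^ 2)⁻¹ • (j₁ x - z • j₀ x))
            - ((1 - z ^ 2)⁻¹ • (j₁ x - z • j₀ x)) * ((1 - z ^ 2)⁻¹ • (j₀ x - z • j₁ x))) = 0) := by
  constructor
  · rintro ⟨hC, hF⟩ z hz x
    rw [lax_curvature hj₀ hj₁ hz, hF, hC, sub_self, smul_zero, sub_zero, smul_zero]
  · intro h
    have key : ∀ z : ℝ, z ^ 2 ≠ 1 → ∀ x,
        (pd0 j₁ x - pd1 j₀ x + (j₀ x * j₁ x - j₁ x * j₀ x))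
          - z • (pd0 j₀ x - pd1 j₁ x) = 0 := by
      intro z hz x
      have hx := h z hz x
      rw [lax_curvature hj₀ hj₁ hz] at hx
      exact (smul_eq_zero.mp hx).resolve_left (inv_ne_zero (sub_ne_zero.mpr hz.symm))
    have hF : ∀ x, pd0 j₁ x - pd1 j₀ x + (j₀ x * j₁ x - j₁ x * j₀ x) = 0 := fun x => by
      simpa only [zero_smul, sub_zero] using key 0 (by norm_num) x
    refine ⟨fun x => ?_, hF⟩
    have hx := key 2 (by norm_num) x
    rw [hF, zero_sub, neg_eq_zero] at hx
    exact sub_eq_zero.mp ((smul_eq_zero.mp hx).resolve_left two_ne_zero)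
end

section
/- Let A₀, A₁, K₀, K₁ : ℝ × ℝ → M_n(ℝ) be differentiable matrix-valued fields, and write D_a X = ∂_a X + [A_a, X] for the covariant derivative. Then the following are equivalent: (1) the symmetric-coset sigma-model equations hold: D₀K₀ − D₁K₁ = 0 (equation of motion D_a K^a = 0), ∂₀A₁ − ∂₁A₀ + [A₀,A₁] + [K₀,K₁] = 0, and D₀K₁ − D₁K₀ = 0; (2) for every real z with z² ≠ 1 the Lax connection L₀ = A₀ + ((z²+1)/(z²−1)) K₀ + (2z/(z²−1)) K₁, L₁ = A₁ + ((z²+1)/(z²−1)) K₁ + (2z/(z²−1)) K₀ has zero curvature: ∂₀L₁ − ∂₁L₀ + [L₀, L₁] = 0 everywhere. (This is the zero-curvature representation of symmetric-space sigma-models.) -/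
attribute [local instance] Matrix.normedAddCommGroup Matrix.normedSpace

/-- Matrix commutator. -/
def mcomm {n : ℕ} (A B : Matrix (Fin n) (Fin n) ℝ) : Matrix (Fin n) (Fin n) ℝ :=
  A * B - B * A

/-- Covariant derivatives `D_a X = ∂_a X + [A_a, X]`. -/
noncomputable def covD0 {n : ℕ} (A₀ : ℝ × ℝ → Matrix (Fin n) (Fin n) ℝ)
    (X : ℝ × ℝ → Matrix (Fin n) (Fin n) ℝ) (x : ℝ × ℝ) : Matrix (Fin n) (Fin n) ℝ :=
  pd0 X x + mcomm (A₀ x) (X x)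

noncomputable def covD1 {n : ℕ} (A₁ : ℝ × ℝ → Matrix (Fin n) (Fin n) ℝ)
    (X : ℝ × ℝ → Matrix (Fin n) (Fin n) ℝ) (x : ℝ × ℝ) : Matrix (Fin n) (Fin n) ℝ :=
  pd1 X x + mcomm (A₁ x) (X x)

theorem pd0_add_smul_add_smul {n : ℕ} {f g h : ℝ × ℝ → Matrix (Fin n) (Fin n) ℝ}
    (hf : Differentiable ℝ f) (hg : Differentiable ℝ g) (hh : Differentiable ℝ h)
    (a b : ℝ) (x : ℝ × ℝ) :
    pd0 (fun y => f y + a • g y + b • h y) x = pd0 f x + a • pd0 g x + b • pd0 h x := by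
  have H := (((hf x).hasFDerivAt.add ((hg x).hasFDerivAt.const_smul a)).add
    ((hh x).hasFDerivAt.const_smul b)).fderiv
  exact congrArg (fun L => L (1, 0)) H

theorem pd1_add_smul_add_smul {n : ℕ} {f g h : ℝ × ℝ → Matrix (Fin n) (Fin n) ℝ}
    (hf : Differentiable ℝ f) (hg : Differentiable ℝ g) (hh : Differentiable ℝ h)
    (a b : ℝ) (x : ℝ × ℝ) :
    pd1 (fun y => f y + a • g y + b • h y) x = pd1 f x + a • pd1 g x + b • pd1 h x := by
  have H := (((hf x).hasFDerivAt.add ((hg x).hasFDerivAt.const_smul a)).add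
    ((hh x).hasFDerivAt.const_smul b)).fderiv
  exact congrArg (fun L => L (0, 1)) H

theorem mcomm_add_smul_add_smul {n : ℕ} (A₀ A₁ K₀ K₁ : Matrix (Fin n) (Fin n) ℝ) (a b : ℝ) :
    mcomm (A₀ + a • K₀ + b • K₁) (A₁ + a • K₁ + b • K₀) =
      mcomm A₀ A₁ + a • (mcomm A₀ K₁ - mcomm A₁ K₀) + b • (mcomm A₀ K₀ - mcomm A₁ K₁)
        + (a ^ 2 - b ^ 2) • mcomm K₀ K₁ := by
  simp only [mcomm, mul_add, add_mul, smul_mul_assoc, mul_smul_comm]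
  module

/-- The curvature of the connection `A_a + a K_a + b ε_{ab} K^b` with `a² - b² = 1`, as a
combination of the field equations. -/
theorem curvature_add_smul_add_smul {n : ℕ} {A₀ A₁ K₀ K₁ : ℝ × ℝ → Matrix (Fin n) (Fin n) ℝ}
    (hA₀ : Differentiable ℝ A₀) (hA₁ : Differentiable ℝ A₁)
    (hK₀ : Differentiable ℝ K₀) (hK₁ : Differentiable ℝ K₁)
    {a b : ℝ} (hab : a ^ 2 - b ^ 2 = 1) (x : ℝ × ℝ) :
    pd0 (fun y => A₁ y + a • K₁ y + b • K₀ y) x - pd1 (fun y => A₀ y + a • K₀ y + b • K₁ y) x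
        + mcomm (A₀ x + a • K₀ x + b • K₁ x) (A₁ x + a • K₁ x + b • K₀ x) =
      (pd0 A₁ x - pd1 A₀ x + mcomm (A₀ x) (A₁ x) + mcomm (K₀ x) (K₁ x))
        + a • (covD0 A₀ K₁ x - covD1 A₁ K₀ x) + b • (covD0 A₀ K₀ x - covD1 A₁ K₁ x) := by
  rw [pd0_add_smul_add_smul hA₁ hK₁ hK₀, pd1_add_smul_add_smul hA₀ hK₀ hK₁,
    mcomm_add_smul_add_smul, hab, covD0, covD0, covD1, covD1]
  module

/-- The symmetric-coset sigma-model equations of motion hold iff the Lax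
connection `L_a = A_a + ((z²+1)/(z²-1)) K_a + (2z/(z²-1)) ε_{ab} K^b` is flat
for all `z` with `z² ≠ 1`. -/
theorem lax_representation_symmetric_coset {n : ℕ}
    (A₀ A₁ K₀ K₁ : ℝ × ℝ → Matrix (Fin n) (Fin n) ℝ)
    (hA₀ : Differentiable ℝ A₀) (hA₁ : Differentiable ℝ A₁)
    (hK₀ : Differentiable ℝ K₀) (hK₁ : Differentiable ℝ K₁) :
    ((∀ x, covD0 A₀ K₀ x - covD1 A₁ K₁ x = 0) ∧
      (∀ x, pd0 A₁ x - pd1 A₀ x + mcomm (A₀ x) (A₁ x) + mcomm (K₀ x) (K₁ x) = 0) ∧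
      (∀ x, covD0 A₀ K₁ x - covD1 A₁ K₀ x = 0)) ↔
    (∀ z : ℝ, z ^ 2 ≠ 1 →
      ∀ x, pd0 (fun y => A₁ y + ((z ^ 2 + 1) / (z ^ 2 - 1)) • K₁ y
              + (2 * z / (z ^ 2 - 1)) • K₀ y) x
          - pd1 (fun y => A₀ y + ((z ^ 2 + 1) / (z ^ 2 - 1)) • K₀ y
              + (2 * z / (z ^ 2 - 1)) • K₁ y) x
          + mcomm (A₀ x + ((z ^ 2 + 1) / (z ^ 2 - 1)) • K₀ x
              + (2 * z / (z ^ 2 - 1)) • K₁ x)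
              (A₁ x + ((z ^ 2 + 1) / (z ^ 2 - 1)) • K₁ x
              + (2 * z / (z ^ 2 - 1)) • K₀ x) = 0) := by
  have curv (z : ℝ) (hz : z ^ 2 ≠ 1) (x : ℝ × ℝ) :=
    curvature_add_smul_add_smul hA₀ hA₁ hK₀ hK₁ (a := (z ^ 2 + 1) / (z ^ 2 - 1))
      (b := 2 * z / (z ^ 2 - 1)) (by have := sub_ne_zero.mpr hz; field_simp; ring) x
  constructor
  · rintro ⟨hE, hF, hT⟩ z hz x
    rw [curv z hz x, hE, hF, hT]
    simp
  · intro h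
    have key (x : ℝ × ℝ) : covD0 A₀ K₀ x - covD1 A₁ K₁ x = 0 ∧
        pd0 A₁ x - pd1 A₀ x + mcomm (A₀ x) (A₁ x) + mcomm (K₀ x) (K₁ x) = 0 ∧
        covD0 A₀ K₁ x - covD1 A₁ K₀ x = 0 := by
      have h₀ := (curv 0 (by norm_num) x).symm.trans (h 0 (by norm_num) x)
      have h₂ := (curv 2 (by norm_num) x).symm.trans (h 2 (by norm_num) x)
      have h₃ := (curv (-2) (by norm_num) x).symm.trans (h (-2) (by norm_num) x)
      generalize covD0 A₀ K₀ x - covD1 A₁ K₁ x = E at *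
      generalize pd0 A₁ x - pd1 A₀ x + mcomm (A₀ x) (A₁ x) + mcomm (K₀ x) (K₁ x) = F at *
      generalize covD0 A₀ K₁ x - covD1 A₁ K₀ x = T at *
      refine ⟨?_, ?_, ?_⟩
      · linear_combination (norm := module) (3 / 8 : ℝ) • h₂ - (3 / 8 : ℝ) • h₃
      · linear_combination (norm := module) (5 / 8 : ℝ) • h₀ + (3 / 16 : ℝ) • h₂ + (3 / 16 : ℝ) • h₃
      · linear_combination (norm := module) (3 / 16 : ℝ) • h₂ + (3 / 16 : ℝ) • h₃ - (3 / 8 : ℝ) • h₀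
    exact ⟨fun x => (key x).1, fun x => (key x).2.1, fun x => (key x).2.2⟩
end

section
/- Let m > 0 and define the relativistic energy E(p) = √(p² + m²) for p ∈ ℝ. If real momenta p₁, p₂, q₁, q₂ satisfy momentum conservation p₁ + p₂ = q₁ + q₂ and energy conservation E(p₁) + E(p₂) = E(q₁) + E(q₂), then either (q₁ = p₁ and q₂ = p₂) or (q₁ = p₂ and q₂ = p₁). That is, two-body scattering of equal-mass particles in two spacetime dimensions allows only transmission or reflection of the momenta. -/
/-- On a mass shell `(e - p) * (e + p) = c` with `e + p > 0`, the light-cone momentum `e + p`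
determines `p`. -/
lemma eq_of_lightcone_eq {c e p f q : ℝ} (he : (e - p) * (e + p) = c) (hf : (f - q) * (f + q) = c)
    (hpos : 0 < e + p) (h : f + q = e + p) : q = p := by
  have : f - q = e - p := mul_right_cancel₀ hpos.ne' (by rw [he, ← h, hf])
  linarith

/-- Two-body scattering of equal-mass relativistic particles in two spacetime
dimensions allows only transmission or reflection of the momenta. -/
theorem two_body_scattering_transmission_or_reflection
    (m : ℝ) (hm : 0 < m) (E : ℝ → ℝ) (hE : ∀ p, E p = Real.sqrt (p ^ 2 + m ^ 2))
    (p₁ p₂ q₁ q₂ : ℝ)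
    (hmom : p₁ + p₂ = q₁ + q₂)
    (hen : E p₁ + E p₂ = E q₁ + E q₂) :
    (q₁ = p₁ ∧ q₂ = p₂) ∨ (q₁ = p₂ ∧ q₂ = p₁) := by
  have shell (p : ℝ) : (E p - p) * (E p + p) = m ^ 2 := by
    have := Real.sq_sqrt (show 0 ≤ p ^ 2 + m ^ 2 by positivity)
    rw [← hE] at this
    linarith
  have pos (p : ℝ) : 0 < E p + p := by
    have : |p| < E p := by
      rw [hE, ← Real.sqrt_sq_eq_abs]
      exact Real.sqrt_lt_sqrt (sq_nonneg p) (by nlinarith)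
    linarith [neg_abs_le p]
  have hp₁ := shell p₁
  have hp₂ := shell p₂
  have hq₁ := shell q₁
  have hq₂ := shell q₂
  have hsum : (E p₁ + p₁) + (E p₂ + p₂) = (E q₁ + q₁) + (E q₂ + q₂) := by linarith
  have hdiff : (E p₁ - p₁) + (E p₂ - p₂) = (E q₁ - q₁) + (E q₂ - q₂) := by linarith
  have hS : 0 < (E p₁ + p₁) + (E p₂ + p₂) := add_pos (pos p₁) (pos p₂)
  have hprod : (E p₁ + p₁) * (E p₂ + p₂) = (E q₁ + q₁) * (E q₂ + q₂) := by
    refine mul_left_cancel₀ (mul_pos (pow_pos hm 2) hS).ne' ?_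
    generalize E p₁ + p₁ = u₁, E p₁ - p₁ = x₁, E p₂ + p₂ = u₂, E p₂ - p₂ = x₂,
      E q₁ + q₁ = v₁, E q₁ - q₁ = y₁, E q₂ + q₂ = v₂, E q₂ - q₂ = y₂ at *
    linear_combination m ^ 2 * u₁ * u₂ * hsum - u₁ * u₂ * v₁ * v₂ * hdiff
      + u₂ * v₁ * v₂ * hp₁ + u₁ * v₁ * v₂ * hp₂ - u₁ * u₂ * v₂ * hq₁ - u₁ * u₂ * v₁ * hq₂
  have hfactor : ((E q₁ + q₁) - (E p₁ + p₁)) * ((E q₁ + q₁) - (E p₂ + p₂)) = 0 := by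
    linear_combination hprod - (E q₁ + q₁) * hsum
  rcases mul_eq_zero.mp hfactor with h | h
  · have := eq_of_lightcone_eq hp₁ hq₁ (pos p₁) (sub_eq_zero.mp h)
    exact Or.inl ⟨this, by linarith⟩
  · have := eq_of_lightcone_eq hp₂ hq₁ (pos p₂) (sub_eq_zero.mp h)
    exact Or.inr ⟨this, by linarith⟩
end

section
/- Let N ≥ 3, Δ = 1/(N − 2), λ = 1/(2πiΔ), and p(θ) = −λθ, k(θ) = λθ − 1/(2Δ). Let A be an associative unital ℂ-algebra containing elements P and K with P·P = 1, K·K = N·K, P·K = K, and K·P = K. Then for every θ ∈ ℂ with θ ≠ 0, k(θ) ≠ 0 and k(−θ) ≠ 0, the product (1 + p(−θ)⁻¹ P + k(−θ)⁻¹ K)·(1 + p(θ)⁻¹ P + k(θ)⁻¹ K) equals the scalar multiple ((θ² + 4π²Δ²)/θ²) · 1 of the identity; in particular the coefficients of P and of K in the product vanish identically. (This is the unitarity computation S(−θ)S(θ) ∝ 1 for the O(N) S-matrix S = σ(θ)(1 + p⁻¹P + k⁻¹K).) -/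
open Complex

/-- If `P` and `K` satisfy the relations of the Brauer algebra with parameter `n`, the product of
`1 + a P + b K` and `1 - a P + c K` is scalar as soon as its `K`-coefficient vanishes. -/
theorem brauer_skeleton_mul {R A : Type*} [CommRing R] [Ring A] [Algebra R A] {n a b c : R}
    {P K : A} (hP2 : P * P = 1) (hK2 : K * K = n • K) (hPK : P * K = K) (hKP : K * P = K)
    (h : b + c + a * c - a * b + n * b * c = 0) :
    (1 + a • P + b • K) * (1 + (-a) • P + c • K) = (1 - a ^ 2) • (1 : A) := by
  have expand : (1 + a • P + b • K) * (1 + (-a) • P + c • K) =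
      (1 - a ^ 2) • (1 : A) + (b + c + a * c - a * b + n * b * c) • K := by
    simp only [add_mul, mul_add, one_mul, mul_one, smul_mul_smul_comm, hP2, hK2, hPK, hKP]
    module
  rw [expand, h, zero_smul, add_zero]

/-- Unitarity computation for the `O(N)` S-matrix skeleton: with `Δ = 1/(N-2)`,
`λ = 1/(2πiΔ)`, `p(θ) = -λθ`, `k(θ) = λθ - 1/(2Δ)`, and `P, K` satisfying the
braiding relations `P² = 1`, `K² = N·K`, `PK = K = KP`, the product
`S(-θ)S(θ)` of skeletons is the scalar `((θ² + 4π²Δ²)/θ²) · 1`. -/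
theorem ON_smatrix_unitarity {A : Type*} [Ring A] [Algebra ℂ A]
    (N : ℕ) (hN : 3 ≤ N)
    (Δ lam : ℂ) (hΔ : Δ = 1 / ((N : ℂ) - 2))
    (hlam : lam = 1 / (2 * (Real.pi : ℂ) * Complex.I * Δ))
    (p k : ℂ → ℂ)
    (hp : ∀ θ, p θ = -(lam * θ))
    (hk : ∀ θ, k θ = lam * θ - 1 / (2 * Δ))
    (P K : A)
    (hP2 : P * P = 1) (hK2 : K * K = (N : ℂ) • K)
    (hPK : P * K = K) (hKP : K * P = K)
    (θ : ℂ) (hθ : θ ≠ 0) (hkθ : k θ ≠ 0) (hkmθ : k (-θ) ≠ 0) :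
    (1 + (p (-θ))⁻¹ • P + (k (-θ))⁻¹ • K) * (1 + (p θ)⁻¹ • P + (k θ)⁻¹ • K) =
      ((θ ^ 2 + 4 * (Real.pi : ℂ) ^ 2 * Δ ^ 2) / θ ^ 2) • (1 : A) := by
  have hN2 : (N : ℂ) - 2 ≠ 0 := by
    rw [sub_ne_zero]
    exact_mod_cast (by omega : N ≠ 2)
  have hΔ0 : Δ ≠ 0 := by simpa [hΔ] using hN2
  have hNΔ : (N : ℂ) = 2 + 1 / Δ := by simp [hΔ]
  have hπ : (Real.pi : ℂ) ≠ 0 := by exact_mod_cast Real.pi_ne_zero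
  have hlam0 : lam ≠ 0 := by simp [hlam, hπ, hΔ0]
  have hpθ : (p θ)⁻¹ = -(p (-θ))⁻¹ := by simp [hp, inv_neg]
  have hcoeff : (k (-θ))⁻¹ + (k θ)⁻¹ + (p (-θ))⁻¹ * (k θ)⁻¹ - (p (-θ))⁻¹ * (k (-θ))⁻¹
      + N * (k (-θ))⁻¹ * (k θ)⁻¹ = 0 := by
    have hp0 : p (-θ) ≠ 0 := by simp [hp, hlam0, hθ]
    have key : p (-θ) * (k θ + k (-θ)) + k (-θ) - k θ + N * p (-θ) = 0 := by
      rw [hp, hk, hk, hNΔ]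
      field_simp
      ring
    field_simp
    linear_combination key
  rw [hpθ, brauer_skeleton_mul hP2 hK2 hPK hKP hcoeff]
  congr 1
  rw [hp, hlam]
  field_simp
  simp only [Complex.I_sq]
  ring
end

section
/- Let N ≥ 3 be a natural number and Δ = 1/(N − 2). Define Q(θ) = Γ(1/2 − iθ/(2π))·Γ(Δ − iθ/(2π)) / (Γ(−iθ/(2π))·Γ(1/2 + Δ − iθ/(2π))) and the dressing factor σ(θ) = Q(θ)·Q(iπ − θ), where Γ is the complex Gamma function. Then for every real θ ≠ 0, the unitarity relation σ(−θ)·σ(θ) = θ² / (θ² + 4π²Δ²) holds. -/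
open Complex

/-- The Gamma-function quotient behind the unitarity of the `O(N)` dressing factor, in the
rescaled rapidity `x`. -/
theorem gamma_quotient_unitarity {d x : ℂ}
    (hhp : Gamma (1 / 2 + x) ≠ 0) (hhm : Gamma (1 / 2 - x) ≠ 0)
    (hxp : Gamma x ≠ 0) (hxm : Gamma (-x) ≠ 0)
    (hdhp : Gamma (1 / 2 + d + x) ≠ 0) (hdhm : Gamma (1 / 2 + d - x) ≠ 0)
    (hdp : Gamma (d + x) ≠ 0) (hdm : Gamma (d - x) ≠ 0)
    (hx : x ≠ 0) (hp : d + x ≠ 0) (hm : d - x ≠ 0) :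
    Gamma (1 / 2 + x) * Gamma (d + x) / (Gamma x * Gamma (1 / 2 + d + x)) *
        (Gamma (-x + 1) * Gamma (1 / 2 + d - x) /
          (Gamma (1 / 2 - x) * Gamma (d - x + 1))) *
      (Gamma (1 / 2 - x) * Gamma (d - x) / (Gamma (-x) * Gamma (1 / 2 + d - x)) *
        (Gamma (x + 1) * Gamma (1 / 2 + d + x) /
          (Gamma (1 / 2 + x) * Gamma (d + x + 1)))) =
      -x ^ 2 / (d ^ 2 - x ^ 2) := by
  rw [Gamma_add_one _ hx, Gamma_add_one _ (neg_ne_zero.mpr hx), Gamma_add_one _ hp,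
    Gamma_add_one _ hm, show d ^ 2 - x ^ 2 = (d + x) * (d - x) by ring]
  generalize Gamma (1 / 2 + x) = a at *
  generalize Gamma (1 / 2 - x) = b at *
  generalize Gamma x = c at *
  generalize Gamma (-x) = e at *
  generalize Gamma (1 / 2 + d + x) = f at *
  generalize Gamma (1 / 2 + d - x) = g at *
  generalize Gamma (d + x) = u at *
  generalize Gamma (d - x) = v at *
  field_simp

/-- The dressing factor `σ(θ) = Q(θ) Q(iπ - θ)` of the `O(N)` model, built from
Gamma functions, satisfies the unitarity relation
`σ(-θ) σ(θ) = θ²/(θ² + 4π²Δ²)` for real `θ ≠ 0`. -/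
theorem ON_dressing_factor_unitarity (N : ℕ) (hN : 3 ≤ N)
    (Δ : ℂ) (hΔ : Δ = 1 / ((N : ℂ) - 2))
    (Q σ : ℂ → ℂ)
    (hQ : ∀ θ : ℂ, Q θ =
      Complex.Gamma (1 / 2 - I * θ / (2 * (Real.pi : ℂ))) *
        Complex.Gamma (Δ - I * θ / (2 * (Real.pi : ℂ))) /
      (Complex.Gamma (-(I * θ) / (2 * (Real.pi : ℂ))) *
        Complex.Gamma (1 / 2 + Δ - I * θ / (2 * (Real.pi : ℂ)))))
    (hσ : ∀ θ : ℂ, σ θ = Q θ * Q (I * (Real.pi : ℂ) - θ)) :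
    ∀ θ : ℝ, θ ≠ 0 →
      σ (-(θ : ℂ)) * σ (θ : ℂ) =
        (θ : ℂ) ^ 2 / ((θ : ℂ) ^ 2 + 4 * (Real.pi : ℂ) ^ 2 * Δ ^ 2) := by
  intro θ hθ
  have hπ : (Real.pi : ℂ) ≠ 0 := ofReal_ne_zero.mpr Real.pi_ne_zero
  obtain ⟨δ, hδ, rfl⟩ : ∃ δ : ℝ, 0 < δ ∧ Δ = (δ : ℂ) := by
    refine ⟨1 / ((N : ℝ) - 2), ?_, by rw [hΔ]; push_cast; rfl⟩
    have : (3 : ℝ) ≤ N := by exact_mod_cast hN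
    exact one_div_pos.mpr (by linarith)
  obtain ⟨t, ht, hθt⟩ : ∃ t : ℝ, t ≠ 0 ∧ θ = 2 * Real.pi * t :=
    ⟨θ / (2 * Real.pi), div_ne_zero hθ (by positivity), by field_simp⟩
  have hx : I * (t : ℂ) ≠ 0 := mul_ne_zero I_ne_zero (ofReal_ne_zero.mpr ht)
  have him : ∀ s : ℝ, s ≠ 0 → Gamma (I * s) ≠ 0 := fun s hs =>
    Gamma_ne_zero fun m hm => hs (by simpa using congrArg Complex.im hm)
  have hm' : Gamma (-(I * (t : ℂ))) ≠ 0 := by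
    simpa using him (-t) (neg_ne_zero.mpr ht)
  have key := gamma_quotient_unitarity (d := (δ : ℂ)) (x := I * t)
    (Gamma_ne_zero_of_re_pos (by simp)) (Gamma_ne_zero_of_re_pos (by simp))
    (him t ht) hm'
    (Gamma_ne_zero_of_re_pos (by simp; positivity))
    (Gamma_ne_zero_of_re_pos (by simp; positivity))
    (Gamma_ne_zero_of_re_pos (by simpa using hδ))
    (Gamma_ne_zero_of_re_pos (by simpa using hδ))
    hx (fun h => hδ.ne' (by simpa using congrArg Complex.re h))
    (fun h => hδ.ne' (by simpa using congrArg Complex.re h))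
  have hθc : (θ : ℂ) = 2 * Real.pi * t := by rw [hθt]; push_cast; rfl
  have hscale : ∀ z : ℂ, I * (2 * Real.pi * z) / (2 * Real.pi) = I * z := fun z => by
    field_simp
  have hQ' : ∀ z : ℂ, Q (2 * Real.pi * z) =
      Gamma (1 / 2 - I * z) * Gamma (δ - I * z) /
        (Gamma (-(I * z)) * Gamma (1 / 2 + δ - I * z)) := fun z => by
    rw [hQ, neg_div, hscale]
  have hcross : ∀ z : ℂ, Q (I * Real.pi - 2 * Real.pi * z) =
      Gamma (I * z + 1) * Gamma (1 / 2 + δ + I * z) /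
        (Gamma (1 / 2 + I * z) * Gamma (δ + I * z + 1)) := fun z => by
    have hI : I * (I / 2 - z) = -1 / 2 - I * z := by
      linear_combination (1 / 2 : ℂ) * I_mul_I
    rw [show I * (Real.pi : ℂ) - 2 * Real.pi * z = 2 * Real.pi * (I / 2 - z) by ring, hQ', hI]
    ring_nf
  rw [hσ, hσ, hθc, ← mul_neg, hQ', hQ', hcross, hcross]
  simp only [mul_neg, neg_neg, sub_neg_eq_add, ← sub_eq_add_neg]
  rw [key, mul_pow, I_sq,
    show (2 * (Real.pi : ℂ) * t) ^ 2 + 4 * (Real.pi : ℂ) ^ 2 * (δ : ℂ) ^ 2 =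
      (4 * (Real.pi : ℂ) ^ 2) * ((δ : ℂ) ^ 2 - -1 * (t : ℂ) ^ 2) by ring,
    show (2 * (Real.pi : ℂ) * t) ^ 2 = (4 * (Real.pi : ℂ) ^ 2) * -(-1 * (t : ℂ) ^ 2) by ring,
    mul_div_mul_left _ _ (mul_ne_zero (by norm_num) (pow_ne_zero 2 hπ))]
end

section
/- Let N ≥ 3 be a natural number and Δ = 1/(N − 2). Define the exact O(N)-model amplitude s(θ) = − [Γ(1 + iθ/(2π))·Γ(1/2 − iθ/(2π))·Γ(Δ − iθ/(2π))·Γ(1/2 + Δ + iθ/(2π))] / [Γ(1 − iθ/(2π))·Γ(1/2 + iθ/(2π))·Γ(Δ + iθ/(2π))·Γ(1/2 + Δ − iθ/(2π))]. Then for every real θ, s satisfies the crossing relation (θ − 2πiΔ)(θ − iπ)·s(iπ − θ) = θ(θ + 2πiΔ − iπ)·s(θ). -/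
open Complex

/-- The ratio of Gamma functions `-Γ(1 + x)Γ(1/2 - x)Γ(Δ - x)Γ(1/2 + Δ + x)` over
`Γ(1 - x)Γ(1/2 + x)Γ(Δ + x)Γ(1/2 + Δ - x)` has an elementary transformation law under the
reflection `x ↦ -1/2 - x`. It holds for all `x` and `Δ`, as `1 / Γ` is entire and satisfies
the recurrence everywhere. -/
theorem Gamma_ratio_reflection (Δ x : ℂ) :
    (x + Δ) * (x + 1 / 2) *
        (-(Gamma (1 + (-1 / 2 - x)) * Gamma (1 / 2 - (-1 / 2 - x)) *
            Gamma (Δ - (-1 / 2 - x)) * Gamma (1 / 2 + Δ + (-1 / 2 - x))) /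
          (Gamma (1 - (-1 / 2 - x)) * Gamma (1 / 2 + (-1 / 2 - x)) *
            Gamma (Δ + (-1 / 2 - x)) * Gamma (1 / 2 + Δ - (-1 / 2 - x)))) =
      x * (x - Δ + 1 / 2) *
        (-(Gamma (1 + x) * Gamma (1 / 2 - x) * Gamma (Δ - x) * Gamma (1 / 2 + Δ + x)) /
          (Gamma (1 - x) * Gamma (1 / 2 + x) * Gamma (Δ + x) * Gamma (1 / 2 + Δ - x))) := by
  have recurrence (z w : ℂ) (h : w = z + 1) : (Gamma z)⁻¹ = z * (Gamma w)⁻¹ := by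
    rw [h, one_div_Gamma_eq_self_mul_one_div_Gamma_add_one]
  rw [show 1 + (-1 / 2 - x) = 1 / 2 - x by ring,
    show 1 / 2 - (-1 / 2 - x) = 1 + x by ring,
    show Δ - (-1 / 2 - x) = 1 / 2 + Δ + x by ring,
    show 1 / 2 + Δ + (-1 / 2 - x) = Δ - x by ring,
    show 1 - (-1 / 2 - x) = 3 / 2 + x by ring,
    show 1 / 2 + (-1 / 2 - x) = -x by ring,
    show Δ + (-1 / 2 - x) = Δ - (1 / 2 + x) by ring,
    show 1 / 2 + Δ - (-1 / 2 - x) = 1 + Δ + x by ring]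
  simp only [div_eq_mul_inv (-(_ : ℂ)), mul_inv (Gamma _), mul_inv (_ * _) (Gamma _)]
  rw [recurrence (-x) (1 - x) (by ring),
    recurrence (Δ - (1 / 2 + x)) (1 / 2 + Δ - x) (by ring),
    recurrence (1 / 2 + x) (3 / 2 + x) (by ring),
    recurrence (Δ + x) (1 + Δ + x) (by ring)]
  ring

/-- The exact `O(N)`-model amplitude `s(θ)`, given by the explicit ratio of
Gamma functions, satisfies the crossing relation
`(θ - 2πiΔ)(θ - iπ) s(iπ - θ) = θ (θ + 2πiΔ - iπ) s(θ)` for real `θ`. -/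
theorem ON_exact_amplitude_crossing (N : ℕ) (hN : 3 ≤ N)
    (Δ : ℂ) (hΔ : Δ = 1 / ((N : ℂ) - 2))
    (s : ℂ → ℂ)
    (hs : ∀ θ : ℂ, s θ =
      -(Complex.Gamma (1 + I * θ / (2 * (Real.pi : ℂ))) *
          Complex.Gamma (1 / 2 - I * θ / (2 * (Real.pi : ℂ))) *
          Complex.Gamma (Δ - I * θ / (2 * (Real.pi : ℂ))) *
          Complex.Gamma (1 / 2 + Δ + I * θ / (2 * (Real.pi : ℂ)))) /
        (Complex.Gamma (1 - I * θ / (2 * (Real.pi : ℂ))) *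
          Complex.Gamma (1 / 2 + I * θ / (2 * (Real.pi : ℂ))) *
          Complex.Gamma (Δ + I * θ / (2 * (Real.pi : ℂ))) *
          Complex.Gamma (1 / 2 + Δ - I * θ / (2 * (Real.pi : ℂ))))) :
    ∀ θ : ℝ,
      ((θ : ℂ) - 2 * (Real.pi : ℂ) * I * Δ) * ((θ : ℂ) - I * (Real.pi : ℂ)) *
          s (I * (Real.pi : ℂ) - (θ : ℂ)) =
        (θ : ℂ) * ((θ : ℂ) + 2 * (Real.pi : ℂ) * I * Δ - I * (Real.pi : ℂ)) *
          s (θ : ℂ) := by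
  intro θ
  obtain ⟨x, hx⟩ : ∃ x : ℂ, x = I * θ / (2 * (Real.pi : ℂ)) := ⟨_, rfl⟩
  have hpi : (Real.pi : ℂ) ≠ 0 := ofReal_ne_zero.mpr Real.pi_ne_zero
  have hθ : (θ : ℂ) = -(2 * (Real.pi : ℂ) * I) * x := by
    rw [hx]
    field_simp
    linear_combination (θ : ℂ) * I_sq
  have hreflect : I * (I * (Real.pi : ℂ) - θ) / (2 * (Real.pi : ℂ)) = -1 / 2 - x := by
    rw [hx]
    field_simp
    linear_combination (Real.pi : ℂ) * I_sq
  rw [hs, hs, hreflect, ← hx, hθ]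
  linear_combination (2 * (Real.pi : ℂ) * I) ^ 2 * Gamma_ratio_reflection Δ x
end
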